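/- arXiv:2603.23046 — 2 statements merged into one kernel-verified Lean document; each statement's English description precedes it below -/
import Mathlib

section
/- Suppose Assumption 2 holds, f ∈ S⁰_{μ_f}(X) and g ∈ S⁰_{μ_g}(Y) with μ_f, μ_g ≥ 0, β_k → ∞, (ε_k) is nonincreasing with ε_k ≥ 0, Σ_{k=1}^{∞} α_kε_k < +∞ and β_kε_k → +∞, and let (x_k, y_k, λ_k) be generated by the scheme (disc) with the semi-implicit multiplier choice λ̄_{k+1} = λ_k + α_kβ_k(AZ^δ_{k+1} + BH^δ_k − b) and λ̂_{k+1} = λ_{k+1} (Algorithm 2). Let (x̄*, ȳ*) be the minimal norm solution and λ̄* a dual multiplier with (x̄*, ȳ*, λ̄*) a saddle point of L. Then liminf_{k→∞} ‖(x_k, y_k) − (x̄*, ȳ*)‖ = 0, where ‖(x,y)‖² = ‖x‖² + ‖y‖². -/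
open Filter Topology
open scoped RealInnerProductSpace

/-- Points of a decreasing sequence of closed convex sets whose norm is almost minimal are close to
the minimal norm element of the intersection. -/
theorem exists_norm_sub_lt_of_antitone_closed_convex {E : Type*} [NormedAddCommGroup E]
    [InnerProductSpace ℝ E] [CompleteSpace E] {C : ℕ → Set E} (hC : Antitone C)
    (hclosed : ∀ n, IsClosed (C n)) (hconv : ∀ n, Convex ℝ (C n)) {z : E} (hz : ∀ n, z ∈ C n)
    (hmin : ∀ w, (∀ n, w ∈ C n) → ‖z‖ ≤ ‖w‖) {e : ℝ} (he : 0 < e) :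
    ∃ N, ∃ η > 0, ∀ w ∈ C N, ‖w‖ ^ 2 ≤ ‖z‖ ^ 2 + η → ‖w - z‖ < e := by
  have hproj : ∀ n, ∃ p ∈ C n, ∀ w ∈ C n, ‖w - p‖ ^ 2 ≤ ‖w‖ ^ 2 - ‖p‖ ^ 2 := by
    intro n
    obtain ⟨p, hp, hpe⟩ :=
      exists_norm_eq_iInf_of_complete_convex ⟨z, hz n⟩ (hclosed n).isComplete (hconv n) (0 : E)
    refine ⟨p, hp, fun w hw => ?_⟩
    have h := (norm_eq_iInf_iff_real_inner_le_zero (hconv n) hp).1 hpe w hw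
    rw [zero_sub, inner_neg_left, inner_sub_right, real_inner_self_eq_norm_sq] at h
    rw [norm_sub_sq_real, real_inner_comm]
    linarith
  choose p hpC hp using hproj
  have hmono : Monotone fun n => ‖p n‖ ^ 2 := fun m n hmn => by
    have := hp m (p n) (hC hmn (hpC n))
    have := sq_nonneg ‖p n - p m‖
    dsimp only
    linarith
  have hbdd : ∀ n, ‖p n‖ ^ 2 ≤ ‖z‖ ^ 2 := fun n => by
    have := hp n z (hz n)
    have := sq_nonneg ‖z - p n‖
    linarith
  have hlim := tendsto_atTop_ciSup hmono ⟨‖z‖ ^ 2, by rintro _ ⟨n, rfl⟩; exact hbdd n⟩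
  have hcauchy : CauchySeq p := by
    rw [Metric.cauchySeq_iff']
    intro r hr
    obtain ⟨N, hN⟩ := Metric.cauchySeq_iff'.1 hlim.cauchySeq (r ^ 2) (by positivity)
    refine ⟨N, fun n hn => ?_⟩
    have h1 := hN n hn
    rw [Real.dist_eq] at h1
    have h2 := hp N (p n) (hC hn (hpC n))
    rw [dist_eq_norm]
    exact lt_of_pow_lt_pow_left₀ 2 hr.le (h2.trans_lt ((le_abs_self _).trans_lt h1))
  obtain ⟨q, hq⟩ := cauchySeq_tendsto_of_complete hcauchy
  have hqC : ∀ n, q ∈ C n := fun n =>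
    (hclosed n).mem_of_tendsto hq ((eventually_ge_atTop n).mono fun m hm => hC hm (hpC m))
  have hqz : ‖z - q‖ ^ 2 ≤ ‖z‖ ^ 2 - ‖q‖ ^ 2 :=
    le_of_tendsto_of_tendsto' ((hq.const_sub z).norm.pow 2) ((hq.norm.pow 2).const_sub _)
      fun n => hp n z (hz n)
  have hzq : ‖z‖ ^ 2 ≤ ‖q‖ ^ 2 := pow_le_pow_left₀ (norm_nonneg _) (hmin q hqC) 2
  obtain rfl : z = q := by
    have : ‖z - q‖ ^ 2 = 0 := le_antisymm (by linarith) (sq_nonneg _)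
    exact sub_eq_zero.1 (norm_eq_zero.1 (pow_eq_zero_iff two_ne_zero |>.1 this))
  have hev1 : ∀ᶠ n in atTop, ‖p n - z‖ < e / 2 := by
    have := (tendsto_iff_norm_sub_tendsto_zero.1 hq)
    exact this.eventually (gt_mem_nhds (half_pos he))
  have hev2 : ∀ᶠ n in atTop, ‖z‖ ^ 2 - (e / 2) ^ 2 / 2 < ‖p n‖ ^ 2 :=
    (hq.norm.pow 2).eventually (lt_mem_nhds (by linarith [show 0 < (e / 2) ^ 2 by positivity]))
  obtain ⟨N, hN1, hN2⟩ := (hev1.and hev2).exists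
  refine ⟨N, (e / 2) ^ 2 / 2, by positivity, fun w hw hwn => ?_⟩
  have h1 : ‖w - p N‖ < e / 2 :=
    lt_of_pow_lt_pow_left₀ 2 (half_pos he).le (by linarith [hp N w hw])
  calc ‖w - z‖ = ‖(w - p N) + (p N - z)‖ := by rw [sub_add_sub_cancel]
    _ ≤ ‖w - p N‖ + ‖p N - z‖ := norm_add_le _ _
    _ < e := by linarith

theorem half_norm_sq_sub_le_inner {E : Type*} [NormedAddCommGroup E] [InnerProductSpace ℝ E]
    (p q s : E) : ‖p - s‖ ^ 2 / 2 - ‖q - s‖ ^ 2 / 2 ≤ ⟪p - q, p - s⟫ := by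
  have h : q - s = (p - s) - (p - q) := by abel
  have h2 := sq_nonneg ‖p - q‖
  rw [h, norm_sub_sq_real (p - s) (p - q), real_inner_comm (p - q)]
  linarith

/-- One-step energy estimate for a primal block, with multiplier force `a`. -/
theorem primal_energy_step {E : Type*} [NormedAddCommGroup E] [InnerProductSpace ℝ E]
    {f : E → ℝ} {x₀ x₁ z₀ z₁ s u a : E} {δ τ α β ε μ : ℝ} (hδ : 0 < δ) (hτ : 0 ≤ τ) (hα : 0 < α)
    (hβ : 0 < β) (hε : 0 ≤ ε) (hμ : 0 ≤ μ)
    (hu : ∀ w, f w - f x₁ - ⟪u, w - x₁⟫ ≥ μ / 2 * ‖w - x₁‖ ^ 2)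
    (hz : z₁ = x₁ + (δ / α) • (x₁ - x₀))
    (hstep : (z₁ - z₀) + τ • (x₁ - x₀) = -((δ * α * β) • (u + a + ε • x₁ - μ • (x₁ - z₁)))) :
    ‖z₁ - s‖ ^ 2 / 2 + τ / 2 * ‖x₁ - s‖ ^ 2 + δ * α * β * ⟪a, z₁ - s⟫
        + δ * α * β * (μ / 2 * ‖z₁ - s‖ ^ 2)
        + δ * α * β * (f x₁ - f s + ε / 2 * (‖x₁‖ ^ 2 - ‖s‖ ^ 2))
        + δ ^ 2 * β * (f x₁ - f x₀ + ε / 2 * (‖x₁‖ ^ 2 - ‖x₀‖ ^ 2))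
      ≤ ‖z₀ - s‖ ^ 2 / 2 + τ / 2 * ‖x₀ - s‖ ^ 2 := by
  have ht : 0 < δ / α := by positivity
  have htα : δ * α * β * (δ / α) = δ ^ 2 * β := by field_simp
  have hzs : z₁ - s = (x₁ - s) + (δ / α) • (x₁ - x₀) := by rw [hz]; abel
  have key := congrArg (fun v => ⟪v, z₁ - s⟫) hstep
  simp only [inner_add_left, inner_neg_left, inner_smul_left, RCLike.conj_to_real, inner_sub_left _ _ (z₁ - s)] at key
  have i1 := half_norm_sq_sub_le_inner z₁ z₀ s
  have i2 : ‖x₁ - s‖ ^ 2 / 2 - ‖x₀ - s‖ ^ 2 / 2 ≤ ⟪x₁ - x₀, z₁ - s⟫ := by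
    have := half_norm_sq_sub_le_inner x₁ x₀ s
    rw [hzs, inner_add_right, inner_smul_right, real_inner_self_eq_norm_sq]
    have : 0 ≤ δ / α * ‖x₁ - x₀‖ ^ 2 := by positivity
    linarith
  have i3 : f x₁ - f s + μ / 2 * ‖x₁ - s‖ ^ 2 + δ / α * (f x₁ - f x₀) ≤ ⟪u, z₁ - s⟫ := by
    have h1 := hu s
    have h2 := hu x₀
    have h3 : 0 ≤ μ / 2 * ‖x₀ - x₁‖ ^ 2 := by positivity
    rw [← neg_sub x₁, inner_neg_right, norm_neg] at h1
    rw [← neg_sub x₁ x₀, inner_neg_right] at h2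
    rw [hzs, inner_add_right, inner_smul_right]
    have h4 := mul_le_mul_of_nonneg_left (show f x₁ - f x₀ ≤ ⟪u, x₁ - x₀⟫ by rw [neg_sub] at h2; linarith) ht.le
    linarith
  have i4 : 1 / 2 * (‖x₁‖ ^ 2 - ‖s‖ ^ 2) + δ / α * (1 / 2 * (‖x₁‖ ^ 2 - ‖x₀‖ ^ 2))
      ≤ ⟪x₁, z₁ - s⟫ := by
    have h1 := half_norm_sq_sub_le_inner x₁ s 0
    have h2 := half_norm_sq_sub_le_inner x₁ x₀ 0
    simp only [sub_zero] at h1 h2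
    rw [hzs, inner_add_right, inner_smul_right, real_inner_comm _ x₁, real_inner_comm (x₁ - x₀)]
    have h4 := mul_le_mul_of_nonneg_left h2 ht.le
    linarith
  have i5 : ‖z₁ - s‖ ^ 2 / 2 - ‖x₁ - s‖ ^ 2 / 2 ≤ -⟪x₁ - z₁, z₁ - s⟫ := by
    rw [← inner_neg_left, neg_sub]
    exact half_norm_sq_sub_le_inner z₁ x₁ s
  rw [inner_sub_left] at i1 i2 i5
  have hc : 0 ≤ δ * α * β := by positivity
  have j2 := mul_le_mul_of_nonneg_left i2 hτ
  have j3 := mul_le_mul_of_nonneg_left i3 hc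
  have j4 := mul_le_mul_of_nonneg_left (mul_le_mul_of_nonneg_left i4 hε) hc
  have j5 := mul_le_mul_of_nonneg_left (mul_le_mul_of_nonneg_left i5 hμ) hc
  rw [← htα]
  linarith

/-- One-step estimate for the multiplier, including the semi-implicit coupling term. -/
theorem multiplier_energy_step {E : Type*} [NormedAddCommGroup E] [InnerProductSpace ℝ E]
    {l₀ l₁ s R a c : E} {σ : ℝ} (hl : l₁ = l₀ + σ • R) :
    ‖l₁ - s‖ ^ 2 / 2 - ‖l₀ - s‖ ^ 2 / 2 + σ ^ 2 / 2 * (‖c‖ ^ 2 - ‖a‖ ^ 2) + σ * ⟪s, R⟫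
      ≤ σ * (⟪l₁ + σ • (a - c), R - c⟫ + ⟪l₁, c⟫) := by
  have h0 : ‖l₀ - s‖ ^ 2 = ‖l₁ - s‖ ^ 2 - 2 * (σ * (⟪l₁, R⟫ - ⟪s, R⟫)) + σ ^ 2 * ‖R‖ ^ 2 := by
    rw [show l₀ - s = (l₁ - s) - σ • R by rw [hl]; abel, norm_sub_sq_real, inner_smul_right,
      inner_sub_left, norm_smul, mul_pow, Real.norm_eq_abs, sq_abs]
  have h1 : 0 ≤ σ ^ 2 * ‖(a - c) + R‖ ^ 2 := by positivity
  rw [norm_add_sq_real, norm_sub_sq_real, inner_sub_left] at h1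
  rw [h0]
  simp only [inner_add_left, inner_sub_right, inner_smul_left, inner_sub_left,
    RCLike.conj_to_real, real_inner_self_eq_norm_sq]
  linarith

/-- A Kronecker-type lemma for sequences with weighted summable increments. -/
theorem tendsto_div_zero_of_le_add_mul {V β a : ℕ → ℝ} {m : ℕ} (hβ : ∀ k, m ≤ k → 0 < β k)
    (hmono : ∀ k, m ≤ k → β k ≤ β (k + 1)) (htop : Tendsto β atTop atTop)
    (ha : ∀ k, m ≤ k → 0 ≤ a k) (hsum : Summable a) (hV : ∀ k, m ≤ k → 0 ≤ V k)
    (hstep : ∀ k, m ≤ k → V (k + 1) ≤ V k + β k * a k) :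
    Tendsto (fun k => V k / β k) atTop (𝓝 0) := by
  rw [Metric.tendsto_nhds]
  intro e he
  obtain ⟨N, hN⟩ := Metric.cauchySeq_iff'.1 hsum.hasSum.tendsto_sum_nat.cauchySeq (e / 4) (by positivity)
  set K := max m N
  have hKm : m ≤ K := le_max_left _ _
  have hind : ∀ k, K ≤ k → V k ≤ V K + β k * (∑ j ∈ Finset.range k, a j - ∑ j ∈ Finset.range K, a j) := by
    intro k hk
    induction k, hk using Nat.le_induction with
    | base => simp
    | succ k hk ih =>
      have hmk := hKm.trans hk
      have hnn : 0 ≤ ∑ j ∈ Finset.range k, a j - ∑ j ∈ Finset.range K, a j := by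
        rw [← Finset.sum_Ico_eq_sub _ hk]
        exact Finset.sum_nonneg fun j hj => ha j (hKm.trans (Finset.mem_Ico.1 hj).1)
      have h1 := hstep k hmk
      have h2 := mul_le_mul_of_nonneg_right (hmono k hmk) (add_nonneg hnn (ha k hmk))
      rw [Finset.sum_range_succ]
      linarith
  filter_upwards [htop.eventually_gt_atTop (V K / (e / 4)), eventually_ge_atTop K] with k hk1 hk
  have hβk := hβ k (hKm.trans hk)
  rw [div_lt_iff₀ (by positivity)] at hk1
  have h1 := hN k ((le_max_right _ _).trans hk)
  have h2 := hN K (le_max_right _ _)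
  rw [Real.dist_eq, abs_lt] at h1 h2
  have h3 := mul_lt_mul_of_pos_left
    (show ∑ j ∈ Finset.range k, a j - ∑ j ∈ Finset.range K, a j < e / 2 by linarith) hβk
  rw [Real.dist_eq, sub_zero, abs_of_nonneg (div_nonneg (hV k (hKm.trans hk)) hβk.le),
    div_lt_iff₀ hβk]
  linarith [hind k hk, mul_pos he hβk]

/-- The constraint residual vanishes when the multipliers grow at most like `√β`. -/
theorem tendsto_residual_zero {E : Type*} [NormedAddCommGroup E] [InnerProductSpace ℝ E]
    {lam r : ℕ → E} {s : E} {α β : ℕ → ℝ} {δ D : ℝ} {m : ℕ} (hδ : 0 < δ)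
    (hα : ∀ k, m ≤ k → 0 < α k) (hβ : ∀ k, m ≤ k → 0 < β k)
    (hmono : ∀ k, m ≤ k → β k ≤ β (k + 1)) (htop : Tendsto β atTop atTop)
    (hββ : ∀ k, m ≤ k → δ * β (k + 1) ≤ δ * β k + α k * β k)
    (hlam : ∀ k, m ≤ k →
      lam (k + 1) = lam k + (α k * β k) • (r (k + 1) + (δ / α k) • (r (k + 1) - r k)))
    (hD : ∀ k, m ≤ k → ‖lam k - s‖ ^ 2 ≤ D * β k) :
    Tendsto r atTop (𝓝 0) := by
  set q : ℕ → E := fun k => (δ * β k) • r k - (lam k - s) with hq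
  set D' := D + ‖q m‖ ^ 2 / β m with hD'
  have hDD : D ≤ D' := le_add_of_nonneg_right (div_nonneg (sq_nonneg _) (hβ m le_rfl).le)
  have hρ : ∀ k, m ≤ k → ‖lam k - s‖ ≤ √(D' * β k) := fun k hk =>
    Real.le_sqrt_of_sq_le ((hD k hk).trans (mul_le_mul_of_nonneg_right hDD (hβ k hk).le))
  have hD0 : 0 ≤ D := by
    by_contra! h
    have h1 := hD m le_rfl
    have h2 := mul_neg_of_neg_of_pos h (hβ m le_rfl)
    have h3 := sq_nonneg ‖lam m - s‖
    linarith
  have hD'0 : 0 ≤ D' := hD0.trans hDD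
  have hqk : ∀ k, m ≤ k → ‖q k‖ ≤ √(D' * β k) := by
    intro k hk
    induction k, hk using Nat.le_induction with
    | base =>
      refine Real.le_sqrt_of_sq_le ?_
      rw [hD', add_mul, div_mul_cancel₀ _ (hβ m le_rfl).ne']
      linarith [mul_nonneg hD0 (hβ m le_rfl).le]
    | succ k hk ih =>
      have hmk : m ≤ k + 1 := hk.trans k.le_succ
      have hP : 0 < δ * β k + α k * β k := by
        have := hα k hk
        have := hβ k hk
        positivity
      have hQ : 0 ≤ δ * β (k + 1) := (mul_pos hδ (hβ _ hmk)).le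
      have hrel : (δ * β k + α k * β k) • q (k + 1) = (δ * β (k + 1)) • q k -
          (δ * β k + α k * β k - δ * β (k + 1)) • (lam (k + 1) - s) := by
        have hl : lam k = lam (k + 1) - ((δ * β k + α k * β k) • r (k + 1) - (δ * β k) • r k) := by
          have : α k * β k * (δ / α k) = δ * β k := by
            have := (hα k hk).ne'
            field_simp
          rw [hlam k hk, smul_add, smul_smul, this]
          module
        simp only [hq]
        rw [hl]
        module
      have h1 : (δ * β k + α k * β k) * ‖q (k + 1)‖ ≤ δ * β (k + 1) * ‖q k‖ +
          (δ * β k + α k * β k - δ * β (k + 1)) * ‖lam (k + 1) - s‖ := by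
        have := norm_sub_le ((δ * β (k + 1)) • q k)
          ((δ * β k + α k * β k - δ * β (k + 1)) • (lam (k + 1) - s))
        rwa [← hrel, norm_smul, norm_smul, norm_smul, Real.norm_of_nonneg hP.le,
          Real.norm_of_nonneg hQ, Real.norm_of_nonneg (sub_nonneg.2 (hββ k hk))] at this
      have h2 : √(D' * β k) ≤ √(D' * β (k + 1)) :=
        Real.sqrt_le_sqrt (mul_le_mul_of_nonneg_left (hmono k hk) hD'0)
      have h3 := mul_le_mul_of_nonneg_left (ih.trans h2) hQ
      have h4 := mul_le_mul_of_nonneg_left (hρ _ hmk) (sub_nonneg.2 (hββ k hk))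
      refine le_of_mul_le_mul_left ?_ hP
      linarith
  refine squeeze_zero_norm' (a := fun k => 2 * √D' / δ / √(β k)) ?_
    ((Real.tendsto_sqrt_atTop.comp htop).const_div_atTop _)
  filter_upwards [eventually_ge_atTop m] with k hk
  have hb := hβ k hk
  have h1 : δ * β k * ‖r k‖ ≤ 2 * √D' * √(β k) := by
    have h2 : (δ * β k) • r k = q k + (lam k - s) := by simp [hq]
    have h3 := norm_add_le (q k) (lam k - s)
    rw [← h2, norm_smul, Real.norm_of_nonneg (mul_pos hδ hb).le] at h3
    have h4 := hqk k hk
    have h5 := hρ k hk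
    rw [Real.sqrt_mul hD'0] at h4 h5
    linarith
  have hs : 0 < √(β k) := Real.sqrt_pos.2 hb
  rw [le_div_iff₀ hs, le_div_iff₀ hδ]
  refine le_of_mul_le_mul_right ?_ hs
  calc ‖r k‖ * √(β k) * δ * √(β k) = δ * (√(β k) * √(β k)) * ‖r k‖ := by ring
    _ = δ * β k * ‖r k‖ := by rw [Real.mul_self_sqrt hb.le]
    _ ≤ _ := h1

/-- Consequences of the discrete energy inequality for a vanishing Tikhonov regularization. -/
theorem energy_div_tendsto_zero_and_frequently {W G M α β ε : ℕ → ℝ} {δ c : ℝ} {m : ℕ}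
    (hδ : 0 < δ) (hα : ∀ k, m ≤ k → 0 < α k) (hβ : ∀ k, m ≤ k → 0 < β k)
    (hmono : ∀ k, m ≤ k → β k ≤ β (k + 1)) (htop : Tendsto β atTop atTop)
    (hββ : ∀ k, m ≤ k → δ * β (k + 1) ≤ δ * β k + α k * β k)
    (hε : ∀ k, m ≤ k → 0 ≤ ε k) (hεmono : ∀ k, m ≤ k → ε (k + 1) ≤ ε k)
    (hsum : Summable fun k => α k * ε k)
    (hβε : Tendsto (fun k => β k * ε k) atTop atTop)
    (hW : ∀ k, 0 ≤ W k) (hG : ∀ k, 0 ≤ G k) (hM : ∀ k, 0 ≤ M k) (hc : 0 ≤ c)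
    (hstep : ∀ k, m ≤ k → W (k + 1) + δ ^ 2 * β (k + 1) * G (k + 1)
        + δ * α k * β k * ε k * (M (k + 1) - c) + δ ^ 2 * β k * ε k * (M (k + 1) - M k)
      ≤ W k + δ ^ 2 * β k * G k) :
    Tendsto (fun k => (W k + δ ^ 2 * β k * G k) / β k) atTop (𝓝 0) ∧
      ∀ η > 0, ∃ᶠ k in atTop, M k ≤ c + η := by
  have hcoef : ∀ k, m ≤ k →
      δ ^ 2 * β (k + 1) * ε (k + 1) ≤ (δ * α k * β k + δ ^ 2 * β k) * ε k := fun k hk => by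
    have h1 := mul_le_mul_of_nonneg_left (hββ k hk) hδ.le
    have h2 := hβ _ (hk.trans k.le_succ)
    have h3 := mul_le_mul_of_nonneg_left (hεmono k hk) (show 0 ≤ δ ^ 2 * β (k + 1) by positivity)
    have h4 := mul_le_mul_of_nonneg_right h1 (hε k hk)
    linarith
  constructor
  · have hV := tendsto_div_zero_of_le_add_mul (m := m)
      (V := fun k => W k + δ ^ 2 * β k * G k + δ ^ 2 * β k * ε k * M k)
      (a := fun k => δ * c * (α k * ε k)) hβ hmono htop
      (fun k hk => by have := hα k hk; have := hε k hk; positivity) (hsum.mul_left _)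
      (fun k hk => by
        have := hβ k hk
        have := hε k hk
        have := hW k
        have := hG k
        have := hM k
        positivity)
      (fun k hk => by
        have h1 := mul_le_mul_of_nonneg_right (hcoef k hk) (hM (k + 1))
        have h2 := hstep k hk
        linarith)
    refine squeeze_zero' ?_ ?_ hV
    · filter_upwards [eventually_ge_atTop m] with k hk
      have := hβ k hk
      have := hW k
      have := hG k
      positivity
    · filter_upwards [eventually_ge_atTop m] with k hk
      have h1 := hβ k hk
      have h2 := hε k hk
      have h3 := hM k
      exact div_le_div_of_nonneg_right (le_add_of_nonneg_right (by positivity)) h1.le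
  · intro η hη
    by_contra hcon
    obtain ⟨K, hK⟩ := (not_frequently.1 hcon).exists_forall_of_atTop
    set K' := max K m
    have hKm : m ≤ K' := le_max_right _ _
    have hKM : ∀ k, K' ≤ k → c + η < M k := fun k hk => not_le.1 (hK k ((le_max_left _ _).trans hk))
    set U : ℕ → ℝ := fun k => W k + δ ^ 2 * β k * G k + δ ^ 2 * β k * ε k * (M k - c) with hU
    have hUle : ∀ k, K' ≤ k → U k ≤ U K' := by
      intro k hk
      induction k, hk using Nat.le_induction with
      | base => exact le_rfl
      | succ k hk ih =>
        refine le_trans ?_ ih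
        have h1 := mul_le_mul_of_nonneg_right (hcoef k (hKm.trans hk))
          (show 0 ≤ M (k + 1) - c by linarith [hKM (k + 1) (hk.trans k.le_succ)])
        have h2 := hstep k (hKm.trans hk)
        simp only [hU]
        linarith
    obtain ⟨k, hk1, hk⟩ := ((hβε.eventually_gt_atTop (U K' / (δ ^ 2 * η))).and
      (eventually_ge_atTop K')).exists
    rw [div_lt_iff₀ (by positivity)] at hk1
    have h1 := hUle k hk
    have h2 := hβ k (hKm.trans hk)
    have h3 := hε k (hKm.trans hk)
    have h4 := hW k
    have h5 := hG k
    have h6 := mul_le_mul_of_nonneg_left (show η ≤ M k - c by linarith [hKM k hk])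
      (show 0 ≤ δ ^ 2 * β k * ε k by positivity)
    have h7 : 0 ≤ δ ^ 2 * β k * G k := by positivity
    have h8 : U k = W k + δ ^ 2 * β k * G k + δ ^ 2 * β k * ε k * (M k - c) := rfl
    linarith

theorem extrapolation_step_identity {E : Type*} [NormedAddCommGroup E] [InnerProductSpace ℝ E]
    {x₀ x₁ v₀ v₁ z₀ z₁ w : E} {δ γ α β : ℝ} (hα : α ≠ 0)
    (hz₀ : z₀ = δ • v₀ + (1 - δ * γ) • x₀) (hz₁ : z₁ = δ • v₁ + (1 - δ * γ) • x₁)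
    (h : (1 / α) • (v₁ - v₀) = -(β • w)) :
    (z₁ - z₀) + (δ * γ - 1) • (x₁ - x₀) = -((δ * α * β) • w) := by
  have hv : v₁ - v₀ = α • ((1 / α) • (v₁ - v₀)) := by
    rw [smul_smul, mul_one_div_cancel hα, one_smul]
  calc (z₁ - z₀) + (δ * γ - 1) • (x₁ - x₀) = δ • (v₁ - v₀) := by rw [hz₀, hz₁]; module
    _ = -((δ * α * β) • w) := by rw [hv, h]; module

theorem extrapolation_eq {E : Type*} [NormedAddCommGroup E] [InnerProductSpace ℝ E]
    {x₀ x₁ v₁ z₁ : E} {δ γ α : ℝ} (hv₁ : v₁ = (1 / α) • (x₁ - x₀) + γ • x₁)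
    (hz₁ : z₁ = δ • v₁ + (1 - δ * γ) • x₁) : z₁ = x₁ + (δ / α) • (x₁ - x₀) := by
  rw [hz₁, hv₁]
  module

/-- Almost feasible, almost optimal points of almost minimal norm are close to the minimal norm
solution. -/
theorem exists_close_to_minimal_norm_solution {X Y Z : Type*}
    [NormedAddCommGroup X] [InnerProductSpace ℝ X] [CompleteSpace X]
    [NormedAddCommGroup Y] [InnerProductSpace ℝ Y] [CompleteSpace Y]
    [NormedAddCommGroup Z] [InnerProductSpace ℝ Z]
    {f : X → ℝ} {g : Y → ℝ}
    (hfconv : ConvexOn ℝ Set.univ f) (hfcont : Continuous f)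
    (hgconv : ConvexOn ℝ Set.univ g) (hgcont : Continuous g)
    {A : X →L[ℝ] Z} {B : Y →L[ℝ] Z} {b : Z} {xs : X} {ys : Y} (ls : Z)
    (hfeas : A xs + B ys = b)
    (hopt : ∀ x' y', A x' + B y' = b → f xs + g ys ≤ f x' + g y')
    (hmn : ∀ x' y', A x' + B y' = b →
        (∀ x'' y'', A x'' + B y'' = b → f x' + g y' ≤ f x'' + g y'') →
        ‖xs‖ ^ 2 + ‖ys‖ ^ 2 ≤ ‖x'‖ ^ 2 + ‖y'‖ ^ 2) {e : ℝ} (he : 0 < e) :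
    ∃ ρ > 0, ∃ η > 0, ∀ x y, f x + g y + ⟪ls, A x + B y - b⟫ ≤ f xs + g ys + ρ →
      ‖A x + B y - b‖ ≤ ρ → ‖x‖ ^ 2 + ‖y‖ ^ 2 ≤ ‖xs‖ ^ 2 + ‖ys‖ ^ 2 + η →
      √(‖x - xs‖ ^ 2 + ‖y - ys‖ ^ 2) < e := by
  let P : WithLp 2 (X × Y) →L[ℝ] X :=
    (ContinuousLinearMap.fst ℝ X Y).comp (WithLp.prodContinuousLinearEquiv 2 ℝ X Y).toContinuousLinearMap
  let Q : WithLp 2 (X × Y) →L[ℝ] Y :=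
    (ContinuousLinearMap.snd ℝ X Y).comp (WithLp.prodContinuousLinearEquiv 2 ℝ X Y).toContinuousLinearMap
  have hnorm : ∀ w : WithLp 2 (X × Y), ‖w‖ ^ 2 = ‖P w‖ ^ 2 + ‖Q w‖ ^ 2 := fun w =>
    WithLp.prod_norm_sq_eq_of_L2 w
  let T : WithLp 2 (X × Y) →L[ℝ] Z := A.comp P + B.comp Q
  let F : WithLp 2 (X × Y) → ℝ := fun w => f (P w) + g (Q w) + ⟪ls, T w - b⟫
  have hFcont : Continuous F := by fun_prop
  have hRconv : ConvexOn ℝ Set.univ fun w => ‖T w - b‖ :=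
    ((convexOn_univ_norm (E := Z)).translate_left (-b)).comp_linearMap T.toLinearMap |>.congr
      fun w _ => by simp [sub_eq_add_neg, add_comm]
  have hIconv : ConvexOn ℝ Set.univ fun w => ⟪ls, T w - b⟫ := by
    refine ⟨convex_univ, fun u _ v _ s t _ _ hst => le_of_eq ?_⟩
    have : T (s • u + t • v) - b = s • (T u - b) + t • (T v - b) := by
      rw [map_add, map_smul, map_smul,
        show s • (T u - b) + t • (T v - b) = s • T u + t • T v - (s + t) • b by module, hst, one_smul]
    simp only [this, inner_add_right, inner_smul_right, smul_eq_mul]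
  have hFconv : ConvexOn ℝ Set.univ F :=
    ((hfconv.comp_linearMap P.toLinearMap).add (hgconv.comp_linearMap Q.toLinearMap)).add hIconv
  let C : ℕ → Set (WithLp 2 (X × Y)) := fun n =>
    {w | F w ≤ f xs + g ys + 1 / ((n : ℝ) + 1)} ∩ {w | ‖T w - b‖ ≤ 1 / ((n : ℝ) + 1)}
  have hC : Antitone C := fun m n hmn w hw => by
    have h1 := Nat.one_div_le_one_div (α := ℝ) hmn
    exact ⟨le_trans hw.1 (add_le_add_right h1 _), le_trans hw.2 h1⟩
  have hclosed : ∀ n, IsClosed (C n) := fun n =>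
    (isClosed_le hFcont continuous_const).inter
      (isClosed_le (T.continuous.sub continuous_const).norm continuous_const)
  have hconv : ∀ n, Convex ℝ (C n) := fun n => by
    have h1 := hFconv.convex_le (f xs + g ys + 1 / ((n : ℝ) + 1))
    have h2 := hRconv.convex_le (1 / ((n : ℝ) + 1))
    simp only [Set.mem_univ, true_and] at h1 h2
    exact h1.inter h2
  have hpos : ∀ n : ℕ, 0 < 1 / ((n : ℝ) + 1) := fun n => Nat.one_div_pos_of_nat
  have hz : ∀ n, WithLp.toLp 2 (xs, ys) ∈ C n := fun n => by
    have hT : T (WithLp.toLp 2 (xs, ys)) - b = 0 := sub_eq_zero.2 hfeas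
    refine ⟨?_, ?_⟩
    · change f xs + g ys + ⟪ls, T (WithLp.toLp 2 (xs, ys)) - b⟫ ≤ _
      rw [hT, inner_zero_right]
      linarith [hpos n]
    · rw [Set.mem_ofPred_eq, hT, norm_zero]
      exact (hpos n).le
  have hmin : ∀ w, (∀ n, w ∈ C n) → ‖WithLp.toLp 2 (xs, ys)‖ ≤ ‖w‖ := fun w hw => by
    have hT : T w - b = 0 := by
      refine norm_le_zero_iff.1 (ge_of_tendsto' tendsto_one_div_add_atTop_nhds_zero_nat fun n => ?_)
      exact (hw n).2
    have hF : F w ≤ f xs + g ys := by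
      have h := tendsto_one_div_add_atTop_nhds_zero_nat (𝕜 := ℝ) |>.const_add (f xs + g ys)
      rw [add_zero] at h
      exact ge_of_tendsto' h fun n => (hw n).1
    have hF' : f (P w) + g (Q w) ≤ f xs + g ys := by
      have h : F w = f (P w) + g (Q w) + ⟪ls, T w - b⟫ := rfl
      rwa [h, hT, inner_zero_right, add_zero] at hF
    refine le_of_sq_le_sq ?_ (norm_nonneg _)
    rw [hnorm, hnorm]
    exact hmn _ _ (sub_eq_zero.1 hT) fun x' y' h => hF'.trans (hopt x' y' h)
  obtain ⟨N, η, hη, h⟩ :=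
    exists_norm_sub_lt_of_antitone_closed_convex hC hclosed hconv hz hmin he
  refine ⟨1 / ((N : ℝ) + 1), hpos N, η, hη, fun x y h1 h2 h3 => ?_⟩
  have h4 := h (WithLp.toLp 2 (x, y)) ⟨h1, h2⟩ (by rw [hnorm, hnorm]; exact h3)
  rwa [← Real.sqrt_sq (norm_nonneg _), hnorm] at h4

theorem liminf_to_minimal_norm_solution_algorithm2
    {X Y Z : Type*}
    [NormedAddCommGroup X] [InnerProductSpace ℝ X] [CompleteSpace X]
    [NormedAddCommGroup Y] [InnerProductSpace ℝ Y] [CompleteSpace Y]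
    [NormedAddCommGroup Z] [InnerProductSpace ℝ Z] [CompleteSpace Z]
    (f : X → ℝ) (g : Y → ℝ)
    (hfconv : ConvexOn ℝ Set.univ f) (hfcont : Continuous f)
    (hgconv : ConvexOn ℝ Set.univ g) (hgcont : Continuous g)
    (A : X →L[ℝ] Z) (B : Y →L[ℝ] Z) (b : Z)
    (μf μg : ℝ) (hμf : 0 ≤ μf) (hμg : 0 ≤ μg)
    (hfS : ∀ x u v : X, (∀ w, f w - f x ≥ ⟪v, w - x⟫) →
        f u - f x - ⟪v, u - x⟫ ≥ μf / 2 * ‖u - x‖ ^ 2)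
    (hgS : ∀ y u v : Y, (∀ w, g w - g y ≥ ⟪v, w - y⟫) →
        g u - g y - ⟪v, u - y⟫ ≥ μg / 2 * ‖u - y‖ ^ 2)
    (L : X → Y → Z → ℝ)
    (hL : ∀ x y l, L x y l = f x + g y + ⟪l, A x + B y - b⟫)
    (δ γ : ℝ) (hδ : 0 < δ) (hγ : 0 < γ)
    (α β ε : ℕ → ℝ)
    (hα : ∀ k, 1 ≤ k → 0 < α k)
    (hβpos : ∀ k, 1 ≤ k → 0 < β k)
    (hβmono : ∀ k, 1 ≤ k → β k ≤ β (k + 1))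
    (hεnn : ∀ k, 1 ≤ k → 0 ≤ ε k)
    (hβtop : Tendsto β atTop atTop)
    (x : ℕ → X) (y : ℕ → Y) (lam : ℕ → Z)
    (Zs Zd : ℕ → X) (Hs Hd : ℕ → Y)
    (hZ : ∀ k, 1 ≤ k → Zs (k + 1) = (1 / α k) • (x (k + 1) - x k) + γ • x (k + 1))
    (hZd : ∀ k, 1 ≤ k → Zd (k + 1) = δ • Zs (k + 1) + (1 - δ * γ) • x (k + 1))
    (hH : ∀ k, 1 ≤ k → Hs (k + 1) = (1 / α k) • (y (k + 1) - y k) + γ • y (k + 1))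
    (hHd : ∀ k, 1 ≤ k → Hd (k + 1) = δ • Hs (k + 1) + (1 - δ * γ) • y (k + 1))
    (hlam : ∀ k, 1 ≤ k → lam (k + 1) = lam k + (α k * β k) • (A (Zd (k + 1)) + B (Hd (k + 1)) - b))
    (hstep : ∀ k, 1 ≤ k → ∃ u v,
        (∀ w, f w - f (x (k + 1)) ≥ ⟪u, w - x (k + 1)⟫) ∧
        (∀ w, g w - g (y (k + 1)) ≥ ⟪v, w - y (k + 1)⟫) ∧
        (1 / α k) • (Zs (k + 1) - Zs k) =
          -(β k • (u + (ContinuousLinearMap.adjoint A) (lam k + (α k * β k) • (A (Zd (k + 1)) + B (Hd k) - b)) + ε k • x (k + 1)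
              - μf • (x (k + 1) - Zd (k + 1)))) ∧
        (1 / α k) • (Hs (k + 1) - Hs k) =
          -(β k • (v + (ContinuousLinearMap.adjoint B) (lam (k + 1)) + ε k • y (k + 1)
              - μg • (y (k + 1) - Hd (k + 1)))))
    (hδγ : δ * γ - 1 ≥ 0)
    (hββ : ∀ k, 1 ≤ k → δ * β (k + 1) ≤ δ * β k + α k * β k)
    (hB2 : ∀ k, 1 ≤ k →
        ‖B‖ ^ 2 * ((α (k + 1)) ^ 2 * (β (k + 1)) ^ 2 - (α k) ^ 2 * (β k) ^ 2) ≤ α k * β k * μg)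
    (hεmono : ∀ k, 1 ≤ k → ε (k + 1) ≤ ε k)
    (hsum : Summable (fun k => α k * ε k))
    (hβεtop : Tendsto (fun k => β k * ε k) atTop atTop)
    (xs : X) (ys : Y) (ls : Z)
    (hsaddle : ∀ x' y' l', L xs ys l' ≤ L xs ys ls ∧ L xs ys ls ≤ L x' y' ls)
    (hfeas : A xs + B ys = b)
    (hopt : ∀ x' y', A x' + B y' = b → f xs + g ys ≤ f x' + g y')
    (hmn : ∀ x' y', A x' + B y' = b →
        (∀ x'' y'', A x'' + B y'' = b → f x' + g y' ≤ f x'' + g y'') →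
        ‖xs‖ ^ 2 + ‖ys‖ ^ 2 ≤ ‖x'‖ ^ 2 + ‖y'‖ ^ 2)
    :
    liminf (fun k => Real.sqrt (‖x k - xs‖ ^ 2 + ‖y k - ys‖ ^ 2)) atTop = 0 := by
  have hx₁ : ∀ k, 1 ≤ k → Zd (k + 1) = x (k + 1) + (δ / α k) • (x (k + 1) - x k) := fun k hk =>
    extrapolation_eq (hZ k hk) (hZd k hk)
  have hy₁ : ∀ k, 1 ≤ k → Hd (k + 1) = y (k + 1) + (δ / α k) • (y (k + 1) - y k) := fun k hk =>
    extrapolation_eq (hH k hk) (hHd k hk)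
  have hZd' : ∀ k, 2 ≤ k → Zd k = δ • Zs k + (1 - δ * γ) • x k := fun k hk => by
    obtain ⟨j, rfl⟩ := Nat.exists_eq_add_of_le' hk
    exact hZd (j + 1) (by omega)
  have hHd' : ∀ k, 2 ≤ k → Hd k = δ • Hs k + (1 - δ * γ) • y k := fun k hk => by
    obtain ⟨j, rfl⟩ := Nat.exists_eq_add_of_le' hk
    exact hHd (j + 1) (by omega)
  set r : ℕ → Z := fun k => A (x k) + B (y k) - b with hr
  obtain ⟨G, hG⟩ : ∃ G : ℕ → ℝ, ∀ k, G k = f (x k) + g (y k) + ⟪ls, r k⟫ - (f xs + g ys) :=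
    ⟨_, fun _ => rfl⟩
  obtain ⟨W, hW⟩ : ∃ W : ℕ → ℝ, ∀ k, W k = (‖Zd k - xs‖ ^ 2 / 2 + (δ * γ - 1) / 2 * ‖x k - xs‖ ^ 2)
      + (‖Hd k - ys‖ ^ 2 / 2 + (δ * γ - 1) / 2 * ‖y k - ys‖ ^ 2) + δ * (‖lam k - ls‖ ^ 2 / 2)
      + δ / 2 * ((α k * β k) ^ 2 * ‖B (Hd k - ys)‖ ^ 2) := ⟨_, fun _ => rfl⟩
  obtain ⟨M, hM⟩ : ∃ M : ℕ → ℝ, ∀ k, M k = 1 / 2 * (‖x k‖ ^ 2 + ‖y k‖ ^ 2) := ⟨_, fun _ => rfl⟩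
  set c := 1 / 2 * (‖xs‖ ^ 2 + ‖ys‖ ^ 2) with hc
  have hG0 : ∀ k, 0 ≤ G k := fun k => by
    have h := (hsaddle (x k) (y k) ls).2
    rw [hL, hL, hfeas, sub_self, inner_zero_right] at h
    rw [hG]
    linarith
  have hW1 : ∀ k, δ * (‖lam k - ls‖ ^ 2 / 2) ≤ W k := fun k => by
    have h1 : 0 ≤ (δ * γ - 1) / 2 * ‖x k - xs‖ ^ 2 := by positivity
    have h2 : 0 ≤ (δ * γ - 1) / 2 * ‖y k - ys‖ ^ 2 := by positivity
    have h3 : 0 ≤ δ / 2 * ((α k * β k) ^ 2 * ‖B (Hd k - ys)‖ ^ 2) := by positivity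
    rw [hW]
    linarith [sq_nonneg ‖Zd k - xs‖, sq_nonneg ‖Hd k - ys‖]
  have hW0 : ∀ k, 0 ≤ W k := fun k => le_trans (by positivity) (hW1 k)
  have hM0 : ∀ k, 0 ≤ M k := fun k => by rw [hM]; positivity
  have hc0 : 0 ≤ c := by positivity
  have hlam' : ∀ k, 1 ≤ k →
      lam (k + 1) = lam k + (α k * β k) • (r (k + 1) + (δ / α k) • (r (k + 1) - r k)) := by
    intro k hk
    rw [hlam k hk, hx₁ k hk, hy₁ k hk]
    simp only [hr, map_add, map_smul, map_sub]
    module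
  have henergy : ∀ k, 2 ≤ k → W (k + 1) + δ ^ 2 * β (k + 1) * G (k + 1)
        + δ * α k * β k * ε k * (M (k + 1) - c) + δ ^ 2 * β k * ε k * (M (k + 1) - M k)
      ≤ W k + δ ^ 2 * β k * G k := by
    intro k hk
    have hk1 : 1 ≤ k := by omega
    have hαk := hα k hk1
    have hβk := hβpos k hk1
    obtain ⟨u, v, hu, hv, hxstep, hystep⟩ := hstep k hk1
    have hX := primal_energy_step (s := xs) hδ hδγ hαk hβk (hεnn k hk1) hμf
      (fun w => hfS (x (k + 1)) w u hu) (hx₁ k hk1)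
      (extrapolation_step_identity hαk.ne' (hZd' k hk) (hZd k hk1) hxstep)
    have hY := primal_energy_step (s := ys) hδ hδγ hαk hβk (hεnn k hk1) hμg
      (fun w => hgS (y (k + 1)) w v hv) (hy₁ k hk1)
      (extrapolation_step_identity hαk.ne' (hHd' k hk) (hHd k hk1) hystep)
    have hΛ := mul_le_mul_of_nonneg_left (multiplier_energy_step (s := ls) (a := B (Hd k - ys))
      (c := B (Hd (k + 1) - ys)) (hlam' k hk1)) hδ.le
    have hR : r (k + 1) + (δ / α k) • (r (k + 1) - r k) - B (Hd (k + 1) - ys)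
        = A (Zd (k + 1) - xs) := by
      rw [hx₁ k hk1, hy₁ k hk1]
      simp only [hr, map_add, map_smul, map_sub, ← hfeas]
      module
    have hbar : lam k + (α k * β k) • (A (Zd (k + 1)) + B (Hd k) - b)
        = lam (k + 1) + (α k * β k) • (B (Hd k - ys) - B (Hd (k + 1) - ys)) := by
      rw [hlam k hk1]
      simp only [map_sub]
      module
    rw [hbar, ContinuousLinearMap.adjoint_inner_left] at hX
    rw [ContinuousLinearMap.adjoint_inner_left] at hY
    have ht : α k * β k * (δ / α k) = δ * β k := by field_simp
    have ht' : δ * (α k * β k * (⟪ls, r (k + 1)⟫ + δ / α k * (⟪ls, r (k + 1)⟫ - ⟪ls, r k⟫)))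
        = δ * α k * β k * ⟪ls, r (k + 1)⟫ + δ ^ 2 * β k * (⟪ls, r (k + 1)⟫ - ⟪ls, r k⟫) := by
      linear_combination δ * (⟪ls, r (k + 1)⟫ - ⟪ls, r k⟫) * ht
    rw [hR, inner_add_right ls, inner_smul_right ls,
      inner_sub_right ls (r (k + 1)) (r k), mul_add δ, mul_add δ, ht'] at hΛ
    have hB' : ((α (k + 1) * β (k + 1)) ^ 2 - (α k * β k) ^ 2) * ‖B (Hd (k + 1) - ys)‖ ^ 2
        ≤ α k * β k * μg * ‖Hd (k + 1) - ys‖ ^ 2 := by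
      have h1 : ‖B (Hd (k + 1) - ys)‖ ^ 2 ≤ ‖B‖ ^ 2 * ‖Hd (k + 1) - ys‖ ^ 2 := by
        rw [← mul_pow]
        exact pow_le_pow_left₀ (norm_nonneg _) (B.le_opNorm _) 2
      have h2 := hB2 k hk1
      rcases le_total ((α (k + 1) * β (k + 1)) ^ 2 - (α k * β k) ^ 2) 0 with h | h
      · exact (mul_nonpos_of_nonpos_of_nonneg h (sq_nonneg _)).trans (by positivity)
      · have h3 := mul_le_mul_of_nonneg_left h1 h
        have h4 := mul_le_mul_of_nonneg_right h2 (sq_nonneg ‖Hd (k + 1) - ys‖)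
        linarith
    have hB'' := mul_le_mul_of_nonneg_left hB' (half_pos hδ).le
    have hGk := mul_le_mul_of_nonneg_right (mul_le_mul_of_nonneg_left (hββ k hk1) hδ.le)
      (hG0 (k + 1))
    have hμX : 0 ≤ δ * α k * β k * (μf / 2 * ‖Zd (k + 1) - xs‖ ^ 2) := by positivity
    rw [hG] at hGk
    rw [hW, hW, hG, hG, hM, hM, hc]
    linarith
  obtain ⟨hV, hfreq⟩ := energy_div_tendsto_zero_and_frequently (m := 2) hδ
    (fun k hk => hα k (by omega)) (fun k hk => hβpos k (by omega))
    (fun k hk => hβmono k (by omega)) hβtop (fun k hk => hββ k (by omega))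
    (fun k hk => hεnn k (by omega)) (fun k hk => hεmono k (by omega)) hsum hβεtop
    hW0 hG0 hM0 hc0 henergy
  have hGlim : ∀ ρ > 0, ∀ᶠ k in atTop, G k ≤ ρ := fun ρ hρ => by
    filter_upwards [hV.eventually (gt_mem_nhds (show 0 < δ ^ 2 * ρ by positivity)),
      eventually_ge_atTop 1] with k hk hk1
    have hb := hβpos k hk1
    rw [div_lt_iff₀ hb] at hk
    refine le_of_mul_le_mul_left ?_ (show 0 < δ ^ 2 * β k by positivity)
    linarith [hW0 k]
  have hrlim : Tendsto r atTop (𝓝 0) := by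
    obtain ⟨m, hm⟩ := (hV.eventually (gt_mem_nhds one_pos)).exists_forall_of_atTop
    have hm' : ∀ k, max m 1 ≤ k → 1 ≤ k := fun k hk => (le_max_right _ _).trans hk
    refine tendsto_residual_zero (m := max m 1) (s := ls) (D := 2 / δ) hδ
      (fun k hk => hα k (hm' k hk)) (fun k hk => hβpos k (hm' k hk))
      (fun k hk => hβmono k (hm' k hk)) hβtop (fun k hk => hββ k (hm' k hk))
      (fun k hk => hlam' k (hm' k hk)) fun k hk => ?_
    have hb := hβpos k (hm' k hk)
    have h1 := hm k ((le_max_left _ _).trans hk)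
    rw [div_lt_one hb] at h1
    have h2 := hG0 k
    have h3 : 0 ≤ δ ^ 2 * β k * G k := by positivity
    rw [div_mul_eq_mul_div, le_div_iff₀ hδ]
    linarith [hW1 k]
  have hclose : ∀ e > 0, ∃ᶠ k in atTop, √(‖x k - xs‖ ^ 2 + ‖y k - ys‖ ^ 2) ≤ e := fun e he => by
    obtain ⟨ρ, hρ, η, hη, h⟩ := exists_close_to_minimal_norm_solution hfconv hfcont hgconv hgcont
      ls hfeas hopt hmn he
    have hr' : ∀ᶠ k in atTop, ‖r k‖ ≤ ρ := by
      have := hrlim.norm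
      rw [norm_zero] at this
      exact this.eventually (ge_mem_nhds hρ)
    refine ((hfreq (η / 2) (half_pos hη)).and_eventually ((hGlim ρ hρ).and hr')).mono ?_
    rintro k ⟨h1, h2, h3⟩
    rw [hG] at h2
    rw [hM, hc] at h1
    exact (h (x k) (y k) (by linarith) h3 (by linarith)).le
  have hnn : ∀ᶠ k in atTop, 0 ≤ √(‖x k - xs‖ ^ 2 + ‖y k - ys‖ ^ 2) :=
    Eventually.of_forall fun k => Real.sqrt_nonneg _
  refine le_antisymm (le_of_forall_pos_le_add fun e he => ?_) ?_
  · rw [zero_add]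
    exact liminf_le_of_frequently_le (hclose e he) ⟨0, hnn⟩
  · exact le_liminf_of_le (IsCobounded.of_frequently_le (hclose 1 one_pos)) hnn
end

section
/- Under the hypotheses of the previous statement (Algorithm 2 with semi-implicit multipliers, Assumption 2, (ε_k) nonincreasing, Σ α_kε_k < +∞ and β_kε_k → +∞), suppose in addition that there exists an integer K ≥ 1 such that either ‖x_k‖² + ‖y_k‖² ≥ ‖x̄*‖² + ‖ȳ*‖² for all k ≥ K, or ‖x_k‖² + ‖y_k‖² < ‖x̄*‖² + ‖ȳ*‖² for all k ≥ K. Then lim_{k→∞} ‖(x_k, y_k) − (x̄*, ȳ*)‖ = 0, i.e. (x_k, y_k) converges strongly to the minimal norm solution. -/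
open Filter Topology
open scoped RealInnerProductSpace

/-- A nested sequence of closed convex sets of a Hilbert space, all of which meet a fixed closed
ball around the origin, has a common point in that ball. -/
theorem exists_mem_iInter_norm_le_of_antitone {E : Type*} [NormedAddCommGroup E]
    [InnerProductSpace ℝ E] [CompleteSpace E] {C : ℕ → Set E} (hanti : Antitone C)
    (hclosed : ∀ n, IsClosed (C n)) (hconv : ∀ n, Convex ℝ (C n)) {r : ℝ}
    (hne : ∀ n, ∃ v ∈ C n, ‖v‖ ≤ r) : ∃ v, (∀ n, v ∈ C n) ∧ ‖v‖ ≤ r := by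
  have hmin : ∀ n, ∃ v ∈ C n, ∀ w ∈ C n, ‖v‖ ≤ ‖w‖ := by
    intro n
    obtain ⟨v₀, hv₀, -⟩ := hne n
    obtain ⟨v, hv, hinf⟩ := exists_norm_eq_iInf_of_complete_convex ⟨v₀, hv₀⟩
      (hclosed n).isComplete (hconv n) (0 : E)
    refine ⟨v, hv, fun w hw => ?_⟩
    have h : (⨅ w : C n, ‖(0 : E) - w‖) ≤ ‖(0 : E) - w‖ :=
      ciInf_le (f := fun w : C n => ‖(0 : E) - w‖)
        ⟨0, by rintro _ ⟨w, rfl⟩; positivity⟩ ⟨w, hw⟩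
    rw [← hinf] at h
    simpa using h
  choose v hvC hvmin using hmin
  have hvr : ∀ n, ‖v n‖ ≤ r := fun n => by
    obtain ⟨w, hw, hwr⟩ := hne n
    exact (hvmin n w hw).trans hwr
  have hmono : Monotone fun n => ‖v n‖ ^ 2 := fun m n hmn =>
    pow_le_pow_left₀ (norm_nonneg _) (hvmin m _ (hanti hmn (hvC n))) 2
  have hbdd : BddAbove (Set.range fun n => ‖v n‖ ^ 2) :=
    ⟨r ^ 2, by rintro _ ⟨n, rfl⟩; exact pow_le_pow_left₀ (norm_nonneg _) (hvr n) 2⟩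
  have hdist : ∀ m n, m ≤ n → ‖v m - v n‖ ^ 2 ≤ 2 * (‖v n‖ ^ 2 - ‖v m‖ ^ 2) := by
    intro m n hmn
    have hmid : (1 / 2 : ℝ) • v m + (1 / 2 : ℝ) • v n ∈ C m :=
      hconv m (hvC m) (hanti hmn (hvC n)) (by norm_num) (by norm_num) (by norm_num)
    have h := pow_le_pow_left₀ (norm_nonneg _) (hvmin m _ hmid) 2
    rw [← smul_add, norm_smul, mul_pow] at h
    norm_num at h
    have hpar := parallelogram_law_with_norm ℝ (v m) (v n)
    nlinarith
  have hcauchy : CauchySeq v := by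
    have hc := (tendsto_atTop_ciSup hmono hbdd).cauchySeq
    rw [Metric.cauchySeq_iff'] at hc ⊢
    intro e he
    obtain ⟨N, hN⟩ := hc (e ^ 2 / 2) (by positivity)
    refine ⟨N, fun n hn => ?_⟩
    have h := hN n hn
    rw [Real.dist_eq] at h
    have h' := (le_abs_self _).trans_lt h
    rw [dist_comm, dist_eq_norm]
    have := hdist N n hn
    exact lt_of_pow_lt_pow_left₀ 2 he.le (by linarith)
  obtain ⟨l, hl⟩ := cauchySeq_tendsto_of_complete hcauchy
  exact ⟨l, fun n => (hclosed n).mem_of_tendsto hl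
    (eventually_atTop.2 ⟨n, fun m hm => hanti hm (hvC m)⟩),
    le_of_tendsto' hl.norm hvr⟩

/-- If `H` is convex and continuous, `ws` is a minimal norm element of `{H ≤ 0}`, and `w` is a
sequence with `H (w k) → 0` and asymptotically no larger norm than `ws`, then `w` converges
strongly to `ws`. -/
theorem tendsto_of_convexOn_of_minimal_norm {E : Type*} [NormedAddCommGroup E]
    [InnerProductSpace ℝ E] [CompleteSpace E] {H : E → ℝ} (hconv : ConvexOn ℝ Set.univ H)
    (hcont : Continuous H) {ws : E} (hws : H ws ≤ 0) (hmin : ∀ w, H w ≤ 0 → ‖ws‖ ≤ ‖w‖)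
    {w : ℕ → E} (hw : Tendsto (fun k => H (w k)) atTop (𝓝 0))
    (hnorm : ∀ e > 0, ∀ᶠ k in atTop, ‖w k‖ ^ 2 ≤ ‖ws‖ ^ 2 + e) :
    Tendsto w atTop (𝓝 ws) := by
  have hlow : ∀ r < ‖ws‖, ∃ η > 0, ∀ u, H u ≤ η → r < ‖u‖ := by
    intro r hr
    by_contra! hcon
    obtain ⟨v, hv, hvr⟩ := exists_mem_iInter_norm_le_of_antitone
      (C := fun n : ℕ => {u | H u ≤ 1 / ((n : ℝ) + 1)}) (r := r)
      (fun m n hmn u (hu : H u ≤ _) => hu.trans (Nat.one_div_le_one_div hmn))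
      (fun n => isClosed_le hcont continuous_const)
      (fun n => by simpa using hconv.convex_le (1 / ((n : ℝ) + 1)))
      (fun n => hcon _ Nat.one_div_pos_of_nat)
    have hv0 : H v ≤ 0 := ge_of_tendsto' tendsto_one_div_add_atTop_nhds_zero_nat hv
    exact absurd (hmin v hv0) (by linarith)
  have hlow2 : ∀ e > 0, ∃ η > 0, ∀ u, H u ≤ η → ‖ws‖ ^ 2 - e ≤ ‖u‖ ^ 2 := by
    intro e he
    by_cases hs : ‖ws‖ ^ 2 - e ≤ 0
    · exact ⟨1, one_pos, fun u _ => hs.trans (sq_nonneg _)⟩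
    push Not at hs
    have hr : Real.sqrt (‖ws‖ ^ 2 - e) < ‖ws‖ := by
      rw [Real.sqrt_lt' (by nlinarith [norm_nonneg ws])]
      linarith
    obtain ⟨η, hη, h⟩ := hlow _ hr
    refine ⟨η, hη, fun u hu => ?_⟩
    have := pow_le_pow_left₀ (Real.sqrt_nonneg _) (h u hu).le 2
    rwa [Real.sq_sqrt hs.le] at this
  rw [tendsto_iff_norm_sub_tendsto_zero, Metric.tendsto_atTop']
  intro e he
  obtain ⟨η, hη, hηu⟩ := hlow2 (e ^ 2 / 16) (by positivity)
  have hev := (hnorm (e ^ 2 / 16) (by positivity)).and (hw.eventually (ge_mem_nhds hη))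
  obtain ⟨N, hN⟩ := eventually_atTop.1 hev
  refine ⟨N, fun k hk => ?_⟩
  obtain ⟨h1, h2⟩ := hN k hk.le
  have hmid := hconv.2 (Set.mem_univ (w k)) (Set.mem_univ ws)
    (by norm_num : (0 : ℝ) ≤ 1 / 2) (by norm_num : (0 : ℝ) ≤ 1 / 2) (by norm_num)
  simp only [smul_eq_mul] at hmid
  have h := hηu _ (hmid.trans (by linarith))
  rw [← smul_add, norm_smul, mul_pow] at h
  norm_num at h
  have hpar := parallelogram_law_with_norm ℝ (w k) ws
  rw [Real.dist_0_eq_abs, abs_norm]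
  exact lt_of_pow_lt_pow_left₀ 2 he.le (by nlinarith [sq_pos_of_pos he])

/-- A Kronecker-type lemma. -/
theorem tendsto_div_zero_of_le_add_mul_s15 {W β a : ℕ → ℝ} {K : ℕ} (ha : Summable a)
    (ha0 : ∀ k, K ≤ k → 0 ≤ a k) (hW0 : ∀ k, K ≤ k → 0 ≤ W k)
    (hW : ∀ k, K ≤ k → W (k + 1) ≤ W k + β k * a k)
    (hβ0 : ∀ k, K ≤ k → 0 < β k) (hβ : ∀ k, K ≤ k → β k ≤ β (k + 1))
    (hβtop : Tendsto β atTop atTop) : Tendsto (fun k => W k / β k) atTop (𝓝 0) := by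
  have key : ∀ N, K ≤ N → ∀ k, N ≤ k → W k ≤ W N + β k * ∑ j ∈ Finset.Ico N k, a j := by
    intro N hN k hk
    induction k, hk using Nat.le_induction with
    | base => simp
    | succ k hk ih =>
      have hKk := hN.trans hk
      rw [Finset.sum_Ico_succ_top hk]
      have hs : 0 ≤ ∑ j ∈ Finset.Ico N k, a j + a k :=
        add_nonneg (Finset.sum_nonneg fun j hj => ha0 j (hN.trans (Finset.mem_Ico.1 hj).1))
          (ha0 k hKk)
      have := mul_le_mul_of_nonneg_right (hβ k hKk) hs
      linarith [hW k hKk]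
  rw [Metric.tendsto_atTop]
  intro e he
  have htail : ∃ N, K ≤ N ∧ ∀ k, N ≤ k → ∑ j ∈ Finset.Ico N k, a j < e / 2 := by
    have hc := ha.hasSum.tendsto_sum_nat.cauchySeq
    rw [Metric.cauchySeq_iff'] at hc
    obtain ⟨N, hN⟩ := hc (e / 4) (by positivity)
    refine ⟨max N K, le_max_right _ _, fun k hk => ?_⟩
    have h1 := hN k ((le_max_left _ _).trans hk)
    have h2 := hN (max N K) (le_max_left _ _)
    rw [Finset.sum_Ico_eq_sub _ hk]
    rw [Real.dist_eq, abs_lt] at h1 h2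
    linarith
  obtain ⟨N, hKN, hN⟩ := htail
  have hlim : ∀ᶠ k in atTop, W N / β k < e / 2 :=
    (hβtop.const_div_atTop (W N)).eventually (gt_mem_nhds (by positivity))
  obtain ⟨M, hM⟩ := eventually_atTop.1 hlim
  refine ⟨max M N, fun k hk => ?_⟩
  have hNk : N ≤ k := (le_max_right _ _).trans hk
  have hb := hβ0 k (hKN.trans hNk)
  rw [Real.dist_0_eq_abs, abs_of_nonneg (div_nonneg (hW0 k (hKN.trans hNk)) hb.le)]
  have h1 := hM k ((le_max_left _ _).trans hk)
  have h2 := hN k hNk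
  have h3 := key N hKN k hNk
  rw [div_lt_iff₀ hb] at h1 ⊢
  nlinarith

/-- Decay of the residuals `R` driven by increments of multipliers `l` of size `O(√β)`. -/
theorem tendsto_residual_zero_s15 {Z : Type*} [NormedAddCommGroup Z] [NormedSpace ℝ Z]
    {R l : ℕ → Z} {α β : ℕ → ℝ} {δ M : ℝ} {K : ℕ} (hδ : 0 < δ)
    (hβ0 : ∀ k, K ≤ k → 0 < β k) (hβ : ∀ k, K ≤ k → β k ≤ β (k + 1))
    (hβtop : Tendsto β atTop atTop)
    (hββ : ∀ k, K ≤ k → δ * β (k + 1) ≤ (α k + δ) * β k)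
    (hl : ∀ k, K ≤ k → ‖l k‖ ≤ M * √(β k))
    (hR : ∀ k, K ≤ k → ((α k + δ) * β k) • R (k + 1) = (δ * β k) • R k + (l (k + 1) - l k)) :
    Tendsto R atTop (𝓝 0) := by
  obtain ⟨M', hMM', hM'⟩ : ∃ M', M ≤ M' ∧ ‖(δ * β K) • R K - l K‖ ≤ M' * √(β K) := by
    have hs := Real.sqrt_pos.2 (hβ0 K le_rfl)
    exact ⟨max M (‖(δ * β K) • R K - l K‖ / √(β K)), le_max_left _ _,
      (div_le_iff₀ hs).1 (le_max_right _ _)⟩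
  have hM'0 : 0 ≤ M' := by
    have hs := Real.sqrt_pos.2 (hβ0 K le_rfl)
    exact nonneg_of_mul_nonneg_left ((norm_nonneg _).trans hM') hs
  have hl' : ∀ k, K ≤ k → ‖l k‖ ≤ M' * √(β k) := fun k hk =>
    (hl k hk).trans (mul_le_mul_of_nonneg_right hMM' (Real.sqrt_nonneg _))
  have key : ∀ k, K ≤ k → ‖(δ * β k) • R k - l k‖ ≤ M' * √(β k) := by
    intro k hk
    induction k, hk using Nat.le_induction with
    | base => exact hM'
    | succ k hk ih =>
      have hd : 0 < δ * β (k + 1) := mul_pos hδ (hβ0 _ (by omega))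
      have hda := hββ k hk
      have ha : 0 < (α k + δ) * β k := hd.trans_le hda
      set t := δ * β (k + 1) / ((α k + δ) * β k) with ht
      have ht0 : 0 ≤ t := by positivity
      have ht1 : t ≤ 1 := (div_le_one ha).2 hda
      have hta : δ * β (k + 1) = t * ((α k + δ) * β k) := (div_mul_cancel₀ _ ha.ne').symm
      have heq : (δ * β (k + 1)) • R (k + 1) - l (k + 1)
          = t • ((δ * β k) • R k - l k) - (1 - t) • l (k + 1) := by
        rw [hta, mul_smul, hR k hk]
        module
      have hsq : √(β k) ≤ √(β (k + 1)) := Real.sqrt_le_sqrt (hβ k hk)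
      have h1 : ‖(δ * β k) • R k - l k‖ ≤ M' * √(β (k + 1)) :=
        ih.trans (mul_le_mul_of_nonneg_left hsq hM'0)
      have h2 := hl' (k + 1) (by omega)
      rw [heq]
      refine (norm_sub_le _ _).trans ?_
      rw [norm_smul, norm_smul, Real.norm_of_nonneg ht0, Real.norm_of_nonneg (by linarith)]
      have := mul_le_mul_of_nonneg_left h1 ht0
      have := mul_le_mul_of_nonneg_left h2 (sub_nonneg.2 ht1)
      linarith
  have hbound : ∀ᶠ k in atTop, ‖R k‖ ≤ (2 * M' / δ) / √(β k) := by
    filter_upwards [eventually_ge_atTop K] with k hk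
    have hb := hβ0 k hk
    have hs := Real.sqrt_pos.2 hb
    have h1 : ‖(δ * β k) • R k‖ ≤ 2 * M' * √(β k) := by
      have := norm_add_le ((δ * β k) • R k - l k) (l k)
      rw [sub_add_cancel] at this
      linarith [key k hk, hl' k hk]
    rw [norm_smul, Real.norm_of_nonneg (by positivity)] at h1
    rw [div_div, le_div_iff₀ (by positivity)]
    have hss := Real.mul_self_sqrt hb.le
    have h2 : (‖R k‖ * (δ * √(β k))) * √(β k) ≤ 2 * M' * √(β k) := by
      calc _ = δ * (√(β k) * √(β k)) * ‖R k‖ := by ring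
        _ = δ * β k * ‖R k‖ := by rw [hss]
        _ ≤ _ := h1
    exact le_of_mul_le_mul_right h2 hs
  exact squeeze_zero_norm' hbound
    ((Real.tendsto_sqrt_atTop.comp hβtop).const_div_atTop _)

/-- One-step energy estimate for a single block of primal variables. -/
theorem block_energy_le {X : Type*} [NormedAddCommGroup X] [InnerProductSpace ℝ X]
    {f : X → ℝ} {μ δ γ α β ε : ℝ} {x x' z z' u ζ xs : X}
    (hδ : 0 < δ) (hα : 0 < α) (hβ : 0 < β) (hε : 0 ≤ ε) (hμ : 0 ≤ μ) (hδγ : 0 ≤ δ * γ - 1)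
    (hf : ∀ w, f w - f x' - ⟪u, w - x'⟫ ≥ μ / 2 * ‖w - x'‖ ^ 2)
    (hz' : z' = x' + (δ / α) • (x' - x))
    (hstep : (z' - z) + (δ * γ - 1) • (x' - x)
      = -((δ * α * β) • (u + ζ + ε • x' - μ • (x' - z')))) :
    (‖z' - xs‖ ^ 2 / 2 + (δ * γ - 1) / 2 * ‖x' - xs‖ ^ 2) + δ * α * β * μ / 2 * ‖z' - xs‖ ^ 2
      + δ * α * β * (f x' - f xs) + δ ^ 2 * β * (f x' - f x) + δ * α * β * ⟪ζ, z' - xs⟫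
      + δ * α * β * ε / 2 * (‖x'‖ ^ 2 - ‖xs‖ ^ 2) + δ ^ 2 * β * ε / 2 * (‖x'‖ ^ 2 - ‖x‖ ^ 2)
      ≤ ‖z - xs‖ ^ 2 / 2 + (δ * γ - 1) / 2 * ‖x - xs‖ ^ 2 := by
  obtain ⟨d, rfl⟩ : ∃ d, x = x' - d := ⟨x' - x, by abel⟩
  obtain ⟨q, rfl⟩ : ∃ q, x' = xs + q := ⟨x' - xs, by abel⟩
  obtain ⟨e, rfl⟩ : ∃ e, z = z' - e := ⟨z' - z, by abel⟩
  obtain ⟨p, rfl⟩ : ∃ p, z' = xs + p := ⟨z' - xs, by abel⟩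
  have hp : p = q + (δ / α) • d := by
    have : p = (xs + p) - xs := by abel
    rw [this, hz']; module
  have h1 := hf xs
  have h2 := hf (xs + q - d)
  have he : e = -((δ * α * β) • (u + ζ + ε • (xs + q) - μ • (q - p))) - (δ * γ - 1) • d := by
    have e1 : xs + p - (xs + p - e) = e := by abel
    have e2 : xs + q - (xs + q - d) = d := by abel
    have e3 : xs + q - (xs + p) = q - p := by abel
    rw [e1, e2, e3] at hstep
    rw [← hstep]; abel
  have e1 : xs + p - e - xs = p - e := by abel
  have e2 : xs + q - d - xs = q - d := by abel
  have e3 : xs + q - d - (xs + q) = -d := by abel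
  have e4 : xs - (xs + q) = -q := by abel
  rw [e1, e2]
  rw [e3] at h2
  rw [e4] at h1
  simp only [add_sub_cancel_left, norm_neg, inner_neg_right] at h1 h2 ⊢
  have hip : ⟪e, p⟫ = -(δ * α * β) * (⟪u, p⟫ + ⟪ζ, p⟫ + ε * (⟪xs, p⟫ + ⟪q, p⟫)
      - μ * (⟪q, p⟫ - ‖p‖ ^ 2)) - (δ * γ - 1) * ⟪d, p⟫ := by
    conv_lhs => rw [he]
    simp only [inner_sub_left, inner_neg_left, inner_smul_left, inner_add_left, conj_trivial,
      real_inner_self_eq_norm_sq]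
    ring
  have hup : α * ⟪u, p⟫ = α * ⟪u, q⟫ + δ * ⟪u, d⟫ := by
    rw [hp, inner_add_right, inner_smul_right]; field_simp
  have hxp : α * ⟪xs, p⟫ = α * ⟪xs, q⟫ + δ * ⟪xs, d⟫ := by
    rw [hp, inner_add_right, inner_smul_right]; field_simp
  have hqp : α * ⟪q, p⟫ = α * ‖q‖ ^ 2 + δ * ⟪q, d⟫ := by
    rw [hp, inner_add_right, inner_smul_right, real_inner_self_eq_norm_sq]; field_simp
  have hdp : ⟪d, p⟫ = ⟪q, d⟫ + δ / α * ‖d‖ ^ 2 := by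
    rw [hp, inner_add_right, inner_smul_right, real_inner_self_eq_norm_sq, real_inner_comm]
  have hqq : 0 ≤ ‖q‖ ^ 2 - 2 * ⟪q, p⟫ + ‖p‖ ^ 2 := by
    rw [← norm_sub_sq_real]; positivity
  rw [norm_sub_sq_real p e, norm_sub_sq_real q d, norm_sub_sq_real (xs + q) d,
    norm_add_sq_real xs q, inner_add_left, real_inner_comm e p]
  have k1 := mul_le_mul_of_nonneg_left h1 (by positivity : 0 ≤ δ * α * β)
  have k2 := mul_le_mul_of_nonneg_left h2 (by positivity : 0 ≤ δ ^ 2 * β)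
  have k3 := mul_nonneg (by positivity : 0 ≤ δ * α * β * μ / 2) hqq
  have k4 : 0 ≤ (δ * γ - 1) * (δ / α * ‖d‖ ^ 2 + ‖d‖ ^ 2 / 2) := by positivity
  have k5 : 0 ≤ ‖e‖ ^ 2 := by positivity
  have k6 : 0 ≤ δ * α * β * ε / 2 * ‖q‖ ^ 2 := by positivity
  have k7 : 0 ≤ δ ^ 2 * β * ε / 2 * ‖d‖ ^ 2 := by positivity
  have k8 : 0 ≤ δ ^ 2 * β * (μ / 2 * ‖d‖ ^ 2) := by positivity
  have m1 : (δ * α * β) * ⟪u, p⟫ = δ * β * (α * ⟪u, q⟫ + δ * ⟪u, d⟫) := by rw [← hup]; ring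
  have m2 : (δ * α * β) * ε * (⟪xs, p⟫ + ⟪q, p⟫)
      = δ * β * ε * (α * ⟪xs, q⟫ + δ * ⟪xs, d⟫ + (α * ‖q‖ ^ 2 + δ * ⟪q, d⟫)) := by
    rw [← hxp, ← hqp]; ring
  have m3 : (δ * γ - 1) * ⟪d, p⟫ = (δ * γ - 1) * (⟪q, d⟫ + δ / α * ‖d‖ ^ 2) := by rw [hdp]
  nlinarith only [k1, k2, k3, k4, k5, k6, k7, k8, m1, m2, m3, hip]

/-- One-step energy estimate for the semi-implicit multiplier update. -/
theorem multiplier_energy_le {Z : Type*} [NormedAddCommGroup Z] [InnerProductSpace ℝ Z]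
    {δ c : ℝ} {a e e₀ l l' ls : Z} (hδ : 0 < δ) (hl' : l' = l + c • (a + e)) :
    δ / 2 * ‖l' - ls‖ ^ 2 + δ / 2 * c ^ 2 * ‖e‖ ^ 2
      ≤ δ / 2 * ‖l - ls‖ ^ 2 + δ / 2 * c ^ 2 * ‖e₀‖ ^ 2
        + δ * c * (⟪l + c • (a + e₀), a⟫ + ⟪l', e⟫ - ⟪ls, a + e⟫) := by
  obtain ⟨m, rfl⟩ : ∃ m, l = ls + m := ⟨l - ls, by abel⟩
  subst hl'
  have h1 : ls + m + c • (a + e) - ls = m + c • (a + e) := by abel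
  rw [h1, add_sub_cancel_left]
  have h : 0 ≤ δ / 2 * c ^ 2 * ‖a + e₀‖ ^ 2 := by positivity
  simp only [norm_add_sq_real, norm_smul, mul_pow, inner_add_left, inner_add_right,
    inner_smul_left, inner_smul_right, conj_trivial, Real.norm_eq_abs, sq_abs,
    real_inner_self_eq_norm_sq, real_inner_comm a e₀] at h ⊢
  have c1 := real_inner_comm a e
  have c2 := real_inner_comm a e₀
  nlinarith only [h, c1, c2]

/-- The gap of the Lagrangian plus the norm of the constraint residual is convex. -/
theorem convexOn_lagrangian_add_norm_residual {X Y Z : Type*}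
    [NormedAddCommGroup X] [InnerProductSpace ℝ X] [NormedAddCommGroup Y] [InnerProductSpace ℝ Y]
    [NormedAddCommGroup Z] [InnerProductSpace ℝ Z] {f : X → ℝ} {g : Y → ℝ}
    (hf : ConvexOn ℝ Set.univ f) (hg : ConvexOn ℝ Set.univ g) (A : X →L[ℝ] Z) (B : Y →L[ℝ] Z)
    (b l : Z) (c : ℝ) :
    ConvexOn ℝ Set.univ fun w : WithLp 2 (X × Y) =>
      f w.fst + g w.snd + ⟪l, A w.fst + B w.snd - b⟫ - c + ‖A w.fst + B w.snd - b‖ := by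
  refine ⟨convex_univ, fun v _ w _ s t hs ht hst => ?_⟩
  have h1 := hf.2 (Set.mem_univ v.fst) (Set.mem_univ w.fst) hs ht hst
  have h2 := hg.2 (Set.mem_univ v.snd) (Set.mem_univ w.snd) hs ht hst
  have heq : A (s • v.fst + t • w.fst) + B (s • v.snd + t • w.snd) - b
      = s • (A v.fst + B v.snd - b) + t • (A w.fst + B w.snd - b) := by
    have hb : b = (s + t) • b := by rw [hst, one_smul]
    conv_lhs => rw [hb]
    simp only [map_add, map_smul]
    module
  have h3 := norm_add_le (s • (A v.fst + B v.snd - b)) (t • (A w.fst + B w.snd - b))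
  rw [norm_smul, norm_smul, Real.norm_of_nonneg hs, Real.norm_of_nonneg ht] at h3
  have hc : c = s * c + t * c := by rw [← add_mul, hst, one_mul]
  simp only [WithLp.add_fst, WithLp.add_snd, WithLp.smul_fst, WithLp.smul_snd, smul_eq_mul]
    at h1 h2 ⊢
  rw [heq, inner_add_right, inner_smul_right, inner_smul_right]
  linarith


open Filter Topology
open scoped RealInnerProductSpace

theorem strong_convergence_to_minimal_norm_solution_algorithm2
    {X Y Z : Type*}
    [NormedAddCommGroup X] [InnerProductSpace ℝ X] [CompleteSpace X]
    [NormedAddCommGroup Y] [InnerProductSpace ℝ Y] [CompleteSpace Y]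
    [NormedAddCommGroup Z] [InnerProductSpace ℝ Z] [CompleteSpace Z]
    (f : X → ℝ) (g : Y → ℝ)
    (hfconv : ConvexOn ℝ Set.univ f) (hfcont : Continuous f)
    (hgconv : ConvexOn ℝ Set.univ g) (hgcont : Continuous g)
    (A : X →L[ℝ] Z) (B : Y →L[ℝ] Z) (b : Z)
    (μf μg : ℝ) (hμf : 0 ≤ μf) (hμg : 0 ≤ μg)
    (hfS : ∀ x u v : X, (∀ w, f w - f x ≥ ⟪v, w - x⟫) →
        f u - f x - ⟪v, u - x⟫ ≥ μf / 2 * ‖u - x‖ ^ 2)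
    (hgS : ∀ y u v : Y, (∀ w, g w - g y ≥ ⟪v, w - y⟫) →
        g u - g y - ⟪v, u - y⟫ ≥ μg / 2 * ‖u - y‖ ^ 2)
    (L : X → Y → Z → ℝ)
    (hL : ∀ x y l, L x y l = f x + g y + ⟪l, A x + B y - b⟫)
    (δ γ : ℝ) (hδ : 0 < δ) (hγ : 0 < γ)
    (α β ε : ℕ → ℝ)
    (hα : ∀ k, 1 ≤ k → 0 < α k)
    (hβpos : ∀ k, 1 ≤ k → 0 < β k)
    (hβmono : ∀ k, 1 ≤ k → β k ≤ β (k + 1))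
    (hεnn : ∀ k, 1 ≤ k → 0 ≤ ε k)
    (hβtop : Tendsto β atTop atTop)
    (x : ℕ → X) (y : ℕ → Y) (lam : ℕ → Z)
    (Zs Zd : ℕ → X) (Hs Hd : ℕ → Y)
    (hZ : ∀ k, 1 ≤ k → Zs (k + 1) = (1 / α k) • (x (k + 1) - x k) + γ • x (k + 1))
    (hZd : ∀ k, 1 ≤ k → Zd (k + 1) = δ • Zs (k + 1) + (1 - δ * γ) • x (k + 1))
    (hH : ∀ k, 1 ≤ k → Hs (k + 1) = (1 / α k) • (y (k + 1) - y k) + γ • y (k + 1))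
    (hHd : ∀ k, 1 ≤ k → Hd (k + 1) = δ • Hs (k + 1) + (1 - δ * γ) • y (k + 1))
    (hlam : ∀ k, 1 ≤ k → lam (k + 1) = lam k + (α k * β k) • (A (Zd (k + 1)) + B (Hd (k + 1)) - b))
    (hstep : ∀ k, 1 ≤ k → ∃ u v,
        (∀ w, f w - f (x (k + 1)) ≥ ⟪u, w - x (k + 1)⟫) ∧
        (∀ w, g w - g (y (k + 1)) ≥ ⟪v, w - y (k + 1)⟫) ∧
        (1 / α k) • (Zs (k + 1) - Zs k) =
          -(β k • (u + (ContinuousLinearMap.adjoint A) (lam k + (α k * β k) • (A (Zd (k + 1)) + B (Hd k) - b)) + ε k • x (k + 1)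
              - μf • (x (k + 1) - Zd (k + 1)))) ∧
        (1 / α k) • (Hs (k + 1) - Hs k) =
          -(β k • (v + (ContinuousLinearMap.adjoint B) (lam (k + 1)) + ε k • y (k + 1)
              - μg • (y (k + 1) - Hd (k + 1)))))
    (hδγ : δ * γ - 1 ≥ 0)
    (hββ : ∀ k, 1 ≤ k → δ * β (k + 1) ≤ δ * β k + α k * β k)
    (hB2 : ∀ k, 1 ≤ k →
        ‖B‖ ^ 2 * ((α (k + 1)) ^ 2 * (β (k + 1)) ^ 2 - (α k) ^ 2 * (β k) ^ 2) ≤ α k * β k * μg)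
    (hεmono : ∀ k, 1 ≤ k → ε (k + 1) ≤ ε k)
    (hsum : Summable (fun k => α k * ε k))
    (hβεtop : Tendsto (fun k => β k * ε k) atTop atTop)
    (xs : X) (ys : Y) (ls : Z)
    (hsaddle : ∀ x' y' l', L xs ys l' ≤ L xs ys ls ∧ L xs ys ls ≤ L x' y' ls)
    (hfeas : A xs + B ys = b)
    (hopt : ∀ x' y', A x' + B y' = b → f xs + g ys ≤ f x' + g y')
    (hmn : ∀ x' y', A x' + B y' = b →
        (∀ x'' y'', A x'' + B y'' = b → f x' + g y' ≤ f x'' + g y'') →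
        ‖xs‖ ^ 2 + ‖ys‖ ^ 2 ≤ ‖x'‖ ^ 2 + ‖y'‖ ^ 2)
    (hK : ∃ K : ℕ, 1 ≤ K ∧
        ((∀ k, K ≤ k → ‖xs‖ ^ 2 + ‖ys‖ ^ 2 ≤ ‖x k‖ ^ 2 + ‖y k‖ ^ 2) ∨
         (∀ k, K ≤ k → ‖x k‖ ^ 2 + ‖y k‖ ^ 2 < ‖xs‖ ^ 2 + ‖ys‖ ^ 2)))
    :
    Tendsto (fun k => Real.sqrt (‖x k - xs‖ ^ 2 + ‖y k - ys‖ ^ 2)) atTop (𝓝 0) := by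
  set F : ℕ → ℝ := fun k =>
    f (x k) + g (y k) + ⟪ls, A (x k) + B (y k) - b⟫ - (f xs + g ys) with hFdef
  set D : ℕ → ℝ := fun k => ‖x k‖ ^ 2 + ‖y k‖ ^ 2 - (‖xs‖ ^ 2 + ‖ys‖ ^ 2) with hDdef
  set V : ℕ → ℝ := fun k => δ ^ 2 * β k * F k
    + (‖Zd k - xs‖ ^ 2 / 2 + (δ * γ - 1) / 2 * ‖x k - xs‖ ^ 2)
    + (‖Hd k - ys‖ ^ 2 / 2 + (δ * γ - 1) / 2 * ‖y k - ys‖ ^ 2)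
    + δ / 2 * ‖lam k - ls‖ ^ 2 + δ / 2 * (α k * β k) ^ 2 * ‖B (Hd k - ys)‖ ^ 2 with hVdef
  have hgap : ∀ x' y', 0 ≤ f x' + g y' + ⟪ls, A x' + B y' - b⟫ - (f xs + g ys) := by
    intro x' y'
    have h := (hsaddle x' y' ls).2
    rw [hL, hL, hfeas, sub_self, inner_zero_right, add_zero] at h
    linarith
  have hF0 : ∀ k, 0 ≤ F k := fun k => hgap _ _
  have hT0 : ∀ k, 0 ≤ D k + (‖xs‖ ^ 2 + ‖ys‖ ^ 2) := fun k => by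
    simp only [hDdef, sub_add_cancel]; positivity
  have hVF : ∀ k, 1 ≤ k → δ ^ 2 * β k * F k + δ / 2 * ‖lam k - ls‖ ^ 2 ≤ V k := by
    intro k hk
    have h : 0 ≤ (‖Zd k - xs‖ ^ 2 / 2 + (δ * γ - 1) / 2 * ‖x k - xs‖ ^ 2)
      + (‖Hd k - ys‖ ^ 2 / 2 + (δ * γ - 1) / 2 * ‖y k - ys‖ ^ 2)
      + δ / 2 * (α k * β k) ^ 2 * ‖B (Hd k - ys)‖ ^ 2 := by positivity
    simp only [hVdef]
    linarith
  have hV0 : ∀ k, 1 ≤ k → 0 ≤ V k := fun k hk => by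
    refine le_trans ?_ (hVF k hk)
    have := hF0 k
    have := hβpos k hk
    positivity
  have hZd' : ∀ k, 1 ≤ k → Zd (k + 1) = x (k + 1) + (δ / α k) • (x (k + 1) - x k) := by
    intro k hk
    rw [hZd k hk, hZ k hk]
    module
  have hHd' : ∀ k, 1 ≤ k → Hd (k + 1) = y (k + 1) + (δ / α k) • (y (k + 1) - y k) := by
    intro k hk
    rw [hHd k hk, hH k hk]
    module
  have hdescent : ∀ k, 2 ≤ k → V (k + 1) + δ * (α k * β k * ε k) / 2 * D (k + 1)
      + δ ^ 2 * (β k * ε k) / 2 * (D (k + 1) - D k) ≤ V k := by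
    intro k hk
    have hk1 : 1 ≤ k := by omega
    have ha := hα k hk1
    have hb := hβpos k hk1
    have he := hεnn k hk1
    obtain ⟨j, rfl⟩ : ∃ j, k = j + 1 := ⟨k - 1, by omega⟩
    have hj : 1 ≤ j := by omega
    obtain ⟨u, v, hu, hv, hxs, hys⟩ := hstep (j + 1) hk1
    have hx := block_energy_le (xs := xs) hδ ha hb he hμf hδγ (fun w => hfS _ w u hu)
      (hZd' (j + 1) hk1) (z := Zd (j + 1)) (by
        have e : (Zd (j + 1 + 1) - Zd (j + 1)) + (δ * γ - 1) • (x (j + 1 + 1) - x (j + 1))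
            = (δ * α (j + 1)) • ((1 / α (j + 1)) • (Zs (j + 1 + 1) - Zs (j + 1))) := by
          rw [hZd (j + 1) hk1, hZd j hj, smul_smul]
          have : δ * α (j + 1) * (1 / α (j + 1)) = δ := by field_simp
          rw [this]
          module
        rw [e, hxs, smul_neg, smul_smul])
    have hy := block_energy_le (xs := ys) hδ ha hb he hμg hδγ (fun w => hgS _ w v hv)
      (hHd' (j + 1) hk1) (z := Hd (j + 1)) (by
        have e : (Hd (j + 1 + 1) - Hd (j + 1)) + (δ * γ - 1) • (y (j + 1 + 1) - y (j + 1))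
            = (δ * α (j + 1)) • ((1 / α (j + 1)) • (Hs (j + 1 + 1) - Hs (j + 1))) := by
          rw [hHd (j + 1) hk1, hHd j hj, smul_smul]
          have : δ * α (j + 1) * (1 / α (j + 1)) = δ := by field_simp
          rw [this]
          module
        rw [e, hys, smul_neg, smul_smul])
    generalize j + 1 = k at *
    have hres : ∀ x' y', A x' + B y' - b = A (x' - xs) + B (y' - ys) := by
      intro x' y'
      rw [map_sub, map_sub, ← hfeas]; abel
    have hm := multiplier_energy_le (ls := ls) (e₀ := B (Hd k - ys)) hδ
      ((hlam k hk1).trans (by rw [hres]))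
    rw [← hres, ← hres] at hm
    rw [ContinuousLinearMap.adjoint_inner_left] at hx hy
    have hinn : α k * ⟪ls, A (Zd (k + 1)) + B (Hd (k + 1)) - b⟫
        = α k * ⟪ls, A (x (k + 1)) + B (y (k + 1)) - b⟫
          + δ * (⟪ls, A (x (k + 1)) + B (y (k + 1)) - b⟫ - ⟪ls, A (x k) + B (y k) - b⟫) := by
      have e : A (Zd (k + 1)) + B (Hd (k + 1)) - b = (A (x (k + 1)) + B (y (k + 1)) - b)
          + (δ / α k) • ((A (x (k + 1)) + B (y (k + 1)) - b) - (A (x k) + B (y k) - b)) := by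
        rw [hZd' k hk1, hHd' k hk1]
        simp only [map_add, map_smul, map_sub]
        module
      rw [e, inner_add_right, inner_smul_right, inner_sub_right ls (_ - b)]
      field_simp
    have hBn : ‖B (Hd (k + 1) - ys)‖ ^ 2 * ((α (k + 1) * β (k + 1)) ^ 2 - (α k * β k) ^ 2)
        ≤ α k * β k * μg * ‖Hd (k + 1) - ys‖ ^ 2 := by
      have h1 : ‖B (Hd (k + 1) - ys)‖ ^ 2 ≤ ‖B‖ ^ 2 * ‖Hd (k + 1) - ys‖ ^ 2 := by
        rw [← mul_pow]
        exact pow_le_pow_left₀ (norm_nonneg _) (B.le_opNorm _) 2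
      rcases le_total ((α (k + 1) * β (k + 1)) ^ 2 - (α k * β k) ^ 2) 0 with h | h
      · exact (mul_nonpos_of_nonneg_of_nonpos (by positivity) h).trans (by positivity)
      · have h2 := mul_le_mul_of_nonneg_right h1 h
        have h3 := mul_le_mul_of_nonneg_right (hB2 k hk1) (sq_nonneg ‖Hd (k + 1) - ys‖)
        nlinarith only [h2, h3]
    have hFβ := mul_le_mul_of_nonneg_right (hββ k hk1) (hF0 (k + 1))
    have hFβ' := mul_le_mul_of_nonneg_left hFβ hδ.le
    have hBn' := mul_le_mul_of_nonneg_left hBn (by positivity : 0 ≤ δ / 2)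
    have hinn' : δ * β k * (α k * ⟪ls, A (Zd (k + 1)) + B (Hd (k + 1)) - b⟫) = _ :=
      congrArg (fun t => δ * β k * t) hinn
    have hμ : 0 ≤ δ * α k * β k * μf / 2 * ‖Zd (k + 1) - xs‖ ^ 2 := by positivity
    simp only [hVdef, hDdef, hFdef] at hFβ' ⊢
    linarith only [hx, hy, hm, hinn', hBn', hFβ', hμ]
  have hεβ : ∀ k, 1 ≤ k → δ * (β (k + 1) * ε (k + 1)) ≤ (α k + δ) * β k * ε k := by
    intro k hk
    have h1 := mul_le_mul_of_nonneg_left (hεmono k hk)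
      (mul_nonneg hδ.le (hβpos (k + 1) (by omega)).le)
    have h2 := mul_le_mul_of_nonneg_right (hββ k hk) (hεnn k hk)
    linarith
  set W : ℕ → ℝ := fun k =>
    V k + δ ^ 2 * (β k * ε k) / 2 * (D k + (‖xs‖ ^ 2 + ‖ys‖ ^ 2)) with hWdef
  have hVW : ∀ k, 1 ≤ k → V k ≤ W k := fun k hk => by
    have h1 := hT0 k
    have h2 := hβpos k hk
    have h3 := hεnn k hk
    have : 0 ≤ δ ^ 2 * (β k * ε k) / 2 * (D k + (‖xs‖ ^ 2 + ‖ys‖ ^ 2)) := by positivity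
    simp only [hWdef]
    linarith
  have hWβ : Tendsto (fun k => W k / β k) atTop (𝓝 0) := by
    refine tendsto_div_zero_of_le_add_mul_s15 (K := 2)
      (hsum.mul_left (δ / 2 * (‖xs‖ ^ 2 + ‖ys‖ ^ 2))) (fun k hk => ?_)
      (fun k hk => (hV0 k (by omega)).trans (hVW k (by omega))) (fun k hk => ?_)
      (fun k hk => hβpos k (by omega)) (fun k hk => hβmono k (by omega)) hβtop
    · have h1 := hα k (by omega)
      have h2 := hεnn k (by omega)
      positivity
    · have h1 := hdescent k hk
      have h2 := mul_le_mul_of_nonneg_right (hεβ k (by omega)) (hT0 (k + 1))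
      have h3 := mul_le_mul_of_nonneg_left h2 (by positivity : 0 ≤ δ / 2)
      simp only [hWdef]
      linarith only [h1, h3]
  have hFlim : Tendsto F atTop (𝓝 0) := by
    have h : Tendsto (fun k => W k / β k / δ ^ 2) atTop (𝓝 0) := by
      simpa using hWβ.div_const (δ ^ 2)
    refine squeeze_zero' (Eventually.of_forall hF0) ?_ h
    filter_upwards [eventually_ge_atTop 1] with k hk
    have h2 := hβpos k hk
    rw [div_div, le_div_iff₀ (by positivity)]
    have : 0 ≤ δ / 2 * ‖lam k - ls‖ ^ 2 := by positivity
    linarith [hVF k hk, hVW k hk]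
  have hRlim : Tendsto (fun k => A (x k) + B (y k) - b) atTop (𝓝 0) := by
    obtain ⟨N, hN⟩ := eventually_atTop.1 (hWβ.eventually (ge_mem_nhds one_pos))
    refine tendsto_residual_zero_s15 (l := fun k => lam k - ls) (α := α) (M := √(2 / δ))
      (K := max N 1) hδ (fun k hk => hβpos k (le_of_max_le_right hk))
      (fun k hk => hβmono k (le_of_max_le_right hk)) hβtop
      (fun k hk => by linarith [hββ k (le_of_max_le_right hk)]) (fun k hk => ?_)
      (fun k hk => ?_)
    · have hk1 := le_of_max_le_right hk
      have hb := hβpos k hk1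
      have h1 := hN k (le_of_max_le_left hk)
      rw [div_le_one hb] at h1
      rw [← Real.sqrt_mul (by positivity)]
      refine Real.le_sqrt_of_sq_le ?_
      have : 0 ≤ δ ^ 2 * β k * F k := mul_nonneg (by positivity) (hF0 k)
      rw [div_mul_eq_mul_div, le_div_iff₀ hδ]
      linarith [hVF k hk1, hVW k hk1]
    · have hk1 := le_of_max_le_right hk
      have ha := (hα k hk1).ne'
      have e : A (Zd (k + 1)) + B (Hd (k + 1)) - b = (A (x (k + 1)) + B (y (k + 1)) - b)
          + (δ / α k) • ((A (x (k + 1)) + B (y (k + 1)) - b) - (A (x k) + B (y k) - b)) := by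
        rw [hZd' k hk1, hHd' k hk1]
        simp only [map_add, map_smul, map_sub]
        module
      rw [hlam k hk1, e, smul_add, smul_smul]
      have : α k * β k * (δ / α k) = δ * β k := by field_simp
      rw [this]
      module
  have hDle : ∀ e > 0, ∀ᶠ k in atTop, D k ≤ e := by
    intro e he
    obtain ⟨K, hK1, hK | hK⟩ := hK
    · have hD0 : ∀ k, K ≤ k → 0 ≤ D k := fun k hk => sub_nonneg.2 (hK k hk)
      have hanti : ∀ k, max K 2 ≤ k → V k + δ ^ 2 * (β k * ε k) / 2 * D k
          ≤ V (max K 2) + δ ^ 2 * (β (max K 2) * ε (max K 2)) / 2 * D (max K 2) := by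
        intro k hk
        induction k, hk using Nat.le_induction with
        | base => exact le_rfl
        | succ k hk ih =>
          refine le_trans ?_ ih
          have hk2 : 2 ≤ k := le_of_max_le_right hk
          have h1 := hdescent k hk2
          have h2 := mul_le_mul_of_nonneg_right (hεβ k (by omega))
            (hD0 (k + 1) ((le_of_max_le_left hk).trans (Nat.le_succ k)))
          have h3 := mul_le_mul_of_nonneg_left h2 (by positivity : 0 ≤ δ / 2)
          linarith only [h1, h3]
      set C := V (max K 2) + δ ^ 2 * (β (max K 2) * ε (max K 2)) / 2 * D (max K 2)
      filter_upwards [eventually_ge_atTop (max K 2),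
        hβεtop.eventually_ge_atTop (2 * C / (δ ^ 2 * e)),
        hβεtop.eventually_gt_atTop 0] with k hk h1 h2
      have h3 := hanti k hk
      have h4 := hV0 k (by have := le_of_max_le_right hk; omega)
      rw [div_le_iff₀ (by positivity)] at h1
      have h5 : δ ^ 2 * (β k * ε k) / 2 * D k ≤ δ ^ 2 * (β k * ε k) / 2 * e := by linarith
      exact le_of_mul_le_mul_left h5 (by positivity)
    · filter_upwards [eventually_ge_atTop K] with k hk
      have := hK k hk
      simp only [hDdef]
      linarith
  have hsol : ∀ x' y', f x' + g y' + ⟪ls, A x' + B y' - b⟫ - (f xs + g ys)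
      + ‖A x' + B y' - b‖ ≤ 0 → ‖xs‖ ^ 2 + ‖ys‖ ^ 2 ≤ ‖x'‖ ^ 2 + ‖y'‖ ^ 2 := by
    intro x' y' h
    have h1 := hgap x' y'
    have h2 : A x' + B y' - b = 0 := norm_eq_zero.1 (le_antisymm (by linarith) (norm_nonneg _))
    rw [h2, inner_zero_right, norm_zero] at h
    exact hmn x' y' (sub_eq_zero.1 h2) fun x'' y'' h'' => by linarith [hopt x'' y'' h'']
  have hnsq : ∀ (p : X) (q : Y), ‖WithLp.toLp 2 (p, q)‖ ^ 2 = ‖p‖ ^ 2 + ‖q‖ ^ 2 := fun p q =>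
    WithLp.prod_norm_sq_eq_of_L2 _
  have hlim : Tendsto (fun k => WithLp.toLp 2 (x k, y k)) atTop (𝓝 (WithLp.toLp 2 (xs, ys))) := by
    refine tendsto_of_convexOn_of_minimal_norm
      (convexOn_lagrangian_add_norm_residual hfconv hgconv A B b ls (f xs + g ys))
      (by fun_prop) ?_ (fun w hw => ?_) ?_ (fun e he => ?_)
    · simp [hfeas]
    · refine le_of_sq_le_sq ?_ (norm_nonneg _)
      rw [hnsq, WithLp.prod_norm_sq_eq_of_L2]
      exact hsol _ _ hw
    · simpa using hFlim.add hRlim.norm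
    · filter_upwards [hDle e he] with k hk
      rw [hnsq, hnsq]
      simp only [hDdef] at hk
      linarith
  have h := tendsto_iff_norm_sub_tendsto_zero.1 hlim
  refine h.congr fun k => ?_
  rw [← WithLp.toLp_sub, Prod.mk_sub_mk, ← hnsq, Real.sqrt_sq (norm_nonneg _)]
end
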